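/- arXiv:1211.6631 — 4 statements merged into one kernel-verified Lean document; each statement's English description precedes it below -/
import Mathlib

section
/- Let S, S' ⊆ ℂ be finite nonempty sets and let N₀, N₀' > 0 be real numbers. If f_{S,N₀}(r) = f_{S',N₀'}(r) for every r ∈ ℂ, then S = S' and N₀ = N₀'. (Identifiability of equal-weight homoscedastic complex Gaussian mixtures: the mixture density determines the set of component means and the common component variance.) -/
open Real MeasureTheory ProbabilityTheory Filter

/-- The equal-weight homoscedastic complex Gaussian mixture density
`f_{S,N₀}(r) = (1/|S|) · Σ_{μ ∈ S} (1/(π N₀)) · exp(−|r − μ|²/N₀)`. -/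
noncomputable def mixDensity (S : Finset ℂ) (N₀ : ℝ) (r : ℂ) : ℝ :=
  (S.card : ℝ)⁻¹ * ∑ μ ∈ S, (π * N₀)⁻¹ * Real.exp (-(‖r - μ‖) ^ 2 / N₀)

/-- The probability measure `P_{S,N₀}` on `ℂ` with density `f_{S,N₀}` w.r.t. Lebesgue measure. -/
noncomputable def mixMeasure (S : Finset ℂ) (N₀ : ℝ) : Measure ℂ :=
  volume.withDensity fun r => ENNReal.ofReal (mixDensity S N₀ r)

/-- Kullback–Leibler divergence `∫ log (dP/dQ) dP` of measures (`⊤` if `P` is not absolutely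
continuous w.r.t. `Q` or the log-likelihood ratio is not integrable). -/
noncomputable def klDiv {α : Type*} [MeasurableSpace α] (P Q : Measure α) : EReal := by
  classical
  exact if P ≪ Q ∧ Integrable (llr P Q) P then ((∫ x, llr P Q x ∂P : ℝ) : EReal) else ⊤

lemma mix_upper (S : Finset ℂ) (hS : S.Nonempty) (N : ℝ) (hN : 0 < N) (M t : ℝ)
    (hM : ∀ μ ∈ S, ‖μ‖ ≤ M) (ht : M ≤ t) (h0 : 0 ≤ t) :
    mixDensity S N (t : ℂ) ≤ (π * N)⁻¹ * Real.exp (-(t - M) ^ 2 / N) := by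
  unfold mixDensity
  have hc : (0 : ℝ) < S.card := by exact_mod_cast hS.card_pos
  rw [inv_mul_le_iff₀ hc, ← nsmul_eq_mul]
  apply Finset.sum_le_card_nsmul
  intro μ hμ
  have h1 : t - M ≤ ‖(t : ℂ) - μ‖ := by
    have := norm_sub_norm_le (t : ℂ) μ
    rw [Complex.norm_real, Real.norm_of_nonneg h0] at this
    linarith [hM μ hμ]
  have h2 : 0 ≤ t - M := by linarith
  have := Real.pi_pos
  gcongr

lemma mix_lower (S : Finset ℂ) (hS : S.Nonempty) (N : ℝ) (hN : 0 < N) (M t : ℝ)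
    (hM : ∀ μ ∈ S, ‖μ‖ ≤ M) (h0 : 0 ≤ t) :
    (π * N)⁻¹ * Real.exp (-(t + M) ^ 2 / N) ≤ mixDensity S N (t : ℂ) := by
  unfold mixDensity
  have hc : (0 : ℝ) < S.card := by exact_mod_cast hS.card_pos
  rw [le_inv_mul_iff₀ hc, ← nsmul_eq_mul]
  apply Finset.card_nsmul_le_sum
  intro μ hμ
  have h1 : ‖(t : ℂ) - μ‖ ≤ t + M := by
    have := norm_sub_le (t : ℂ) μ
    rw [Complex.norm_real, Real.norm_of_nonneg h0] at this
    linarith [hM μ hμ]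
  have := Real.pi_pos
  gcongr

lemma mix_var_aux (S S' : Finset ℂ) (hS : S.Nonempty) (hS' : S'.Nonempty)
    (N N' : ℝ) (hN : 0 < N) (hN' : 0 < N')
    (h : ∀ r : ℂ, mixDensity S N r = mixDensity S' N' r) : ¬ N < N' := by
  intro hlt
  obtain ⟨M, hM0, hM⟩ : ∃ M : ℝ, 0 ≤ M ∧ ∀ μ ∈ S ∪ S', ‖μ‖ ≤ M :=
    ⟨∑ μ ∈ S ∪ S', ‖μ‖, Finset.sum_nonneg fun _ _ => norm_nonneg _, fun μ hμ =>
      Finset.single_le_sum (f := fun μ : ℂ => ‖μ‖) (fun _ _ => norm_nonneg _) hμ⟩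
  have hpi := Real.pi_pos
  have key : ∀ t : ℝ, M ≤ t → (t - M) ^ 2 / N - (t + M) ^ 2 / N' ≤
      Real.log ((π * N)⁻¹) - Real.log ((π * N')⁻¹) := by
    intro t ht
    have h0 := hM0.trans ht
    have h1 := mix_upper S hS N hN M t (fun μ hμ => hM μ (Finset.mem_union_left _ hμ)) ht h0
    have h2 := mix_lower S' hS' N' hN' M t (fun μ hμ => hM μ (Finset.mem_union_right _ hμ)) h0
    rw [← h] at h2
    have h3 := Real.log_le_log (by positivity) (h2.trans h1)
    rw [Real.log_mul (by positivity) (by positivity), Real.log_mul (by positivity) (by positivity),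
      Real.log_exp, Real.log_exp, neg_div, neg_div] at h3
    linarith
  generalize Real.log ((π * N)⁻¹) - Real.log ((π * N')⁻¹) = C at key
  have ha : 0 < N⁻¹ - N'⁻¹ := sub_pos.2 (inv_strictAnti₀ hN hlt)
  set a := N⁻¹ - N'⁻¹ with had
  set b := 2 * M * (N⁻¹ + N'⁻¹) with hb
  have hb0 : 0 ≤ b := by positivity
  have key2 : ∀ t : ℝ, M ≤ t → t * (a * t - b) + a * M ^ 2 ≤ C := by
    intro t ht
    have := key t ht
    have e : t * (a * t - b) + a * M ^ 2 = (t - M) ^ 2 / N - (t + M) ^ 2 / N' := by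
      rw [had, hb]; ring
    linarith
  have ht := key2 (M + 1 + (b + |C| + 1) / a) (by
    have : 0 ≤ (b + |C| + 1) / a := by positivity
    linarith)
  set t := M + 1 + (b + |C| + 1) / a with htd
  have e : a * t = a * M + a + (b + |C| + 1) := by rw [htd]; field_simp
  have h1 : |C| + 1 ≤ a * t - b := by nlinarith
  have h2 : 1 ≤ t := by
    have : 0 ≤ (b + |C| + 1) / a := by positivity
    linarith
  have h3 : 0 ≤ a * M ^ 2 := by positivity
  have := le_abs_self C
  have := abs_nonneg C
  nlinarith

noncomputable def mixChar (N : ℝ) (μ : ℂ) : Multiplicative ℂ →* ℝ where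
  toFun r := Real.exp (2 * (r.toAdd.re * μ.re + r.toAdd.im * μ.im) / N)
  map_one' := by simp
  map_mul' x y := by
    rw [← Real.exp_add]
    simp only [toAdd_mul, Complex.add_re, Complex.add_im]
    congr 1; ring

lemma mixChar_inj (N : ℝ) (hN : 0 < N) : Function.Injective (mixChar N) := by
  intro μ ν h
  have h1 := DFunLike.congr_fun h (Multiplicative.ofAdd (1 : ℂ))
  have h2 := DFunLike.congr_fun h (Multiplicative.ofAdd Complex.I)
  simp [mixChar, hN.ne'] at h1 h2
  exact Complex.ext h1 h2

lemma mix_eq (S : Finset ℂ) (N : ℝ) (hN : 0 < N) (r : ℂ) :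
    mixDensity S N r * Real.exp (‖r‖ ^ 2 / N) =
      ∑ μ ∈ S, ((S.card : ℝ)⁻¹ * (π * N)⁻¹ * Real.exp (-‖μ‖ ^ 2 / N)) *
        mixChar N μ (Multiplicative.ofAdd r) := by
  unfold mixDensity
  rw [Finset.mul_sum, Finset.sum_mul]
  refine Finset.sum_congr rfl fun μ _ => ?_
  have : Real.exp (-‖r - μ‖ ^ 2 / N) * Real.exp (‖r‖ ^ 2 / N) =
      Real.exp (-‖μ‖ ^ 2 / N) * mixChar N μ (Multiplicative.ofAdd r) := by
    simp only [mixChar, MonoidHom.coe_mk, OneHom.coe_mk, toAdd_ofAdd]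
    rw [← Real.exp_add, ← Real.exp_add]
    congr 1
    simp only [Complex.sq_norm, Complex.normSq_apply, Complex.sub_re, Complex.sub_im]
    ring
  linear_combination ((S.card : ℝ)⁻¹ * (π * N)⁻¹) * this

/-- Identifiability of equal-weight homoscedastic complex Gaussian mixtures:
the mixture density determines the set of component means and the common variance. -/
theorem mixDensity_injective (S S' : Finset ℂ) (hS : S.Nonempty) (hS' : S'.Nonempty)
    (N₀ N₀' : ℝ) (hN₀ : 0 < N₀) (hN₀' : 0 < N₀')
    (h : ∀ r : ℂ, mixDensity S N₀ r = mixDensity S' N₀' r) :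
    S = S' ∧ N₀ = N₀' := by
  have hN : N₀ = N₀' := le_antisymm
    (not_lt.1 (mix_var_aux S' S hS' hS N₀' N₀ hN₀' hN₀ fun r => (h r).symm))
    (not_lt.1 (mix_var_aux S S' hS hS' N₀ N₀' hN₀ hN₀' h))
  refine ⟨?_, hN⟩
  subst hN
  have hli := (linearIndependent_monoidHom (Multiplicative ℂ) ℝ).comp _ (mixChar_inj N₀ hN₀)
  have hpi := Real.pi_pos
  let c : Finset ℂ → ℂ → ℝ := fun T μ => (T.card : ℝ)⁻¹ * (π * N₀)⁻¹ * Real.exp (-‖μ‖ ^ 2 / N₀)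
  have hc : ∀ T : Finset ℂ, T.Nonempty → ∀ μ, c T μ ≠ 0 := by
    intro T hT μ
    have : (0 : ℝ) < T.card := by exact_mod_cast hT.card_pos
    have : 0 < c T μ := by positivity
    exact this.ne'
  rw [linearIndependent_iff'] at hli
  have := hli (S ∪ S') (fun μ => (if μ ∈ S then c S μ else 0) - (if μ ∈ S' then c S' μ else 0)) (by
    funext x
    have e1 := mix_eq S N₀ hN₀ x.toAdd
    have e2 := mix_eq S' N₀ hN₀ x.toAdd
    rw [h, e2] at e1
    simp only [ofAdd_toAdd] at e1
    simp only [Finset.sum_apply, Pi.smul_apply, Function.comp, smul_eq_mul, sub_mul, ite_mul,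
      zero_mul, Finset.sum_sub_distrib, Pi.zero_apply, ← Finset.sum_filter]
    rw [Finset.filter_mem_eq_inter, Finset.filter_mem_eq_inter, Finset.union_inter_cancel_left,
      Finset.union_inter_cancel_right]
    exact sub_eq_zero.2 e1.symm)
  ext μ
  by_cases h1 : μ ∈ S <;> by_cases h2 : μ ∈ S'
  · simp [h1, h2]
  · have := this μ (Finset.mem_union_left _ h1)
    simp [h1, h2, hc S hS μ] at this
  · have := this μ (Finset.mem_union_right _ h2)
    simp [h1, h2, hc S' hS' μ] at this
  · simp [h1, h2]
end

section
/- Let S, S' ⊆ ℂ be finite nonempty sets and let N₀, N₀' > 0 be real numbers. Then the function r ↦ log f_{S',N₀'}(r) is integrable with respect to the probability measure P_{S,N₀}. -/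
open Real MeasureTheory ProbabilityTheory Filter

lemma gauss_integrable_aux (b : ℝ) (hb : 0 < b) (μ : ℂ) :
    Integrable (fun r : ℂ => Real.exp (-b * ‖r - μ‖ ^ 2)) := by
  have h := (GaussianFourier.integrable_cexp_neg_mul_sq_norm_add (V := ℂ) (b := (b : ℂ))
    (by simpa using hb) 0 0).norm
  have h2 : Integrable (fun r : ℂ => Real.exp (-b * ‖r‖ ^ 2)) := by
    refine h.congr (ae_of_all _ fun r => ?_)
    simp only [Complex.norm_exp]
    congr 1
    simp [← Complex.ofReal_pow]
  exact h2.comp_sub_right μ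

lemma mixDensity_continuous_aux (S : Finset ℂ) (N₀ : ℝ) : Continuous (mixDensity S N₀) := by
  unfold mixDensity
  fun_prop

lemma mixDensity_nonneg_aux (S : Finset ℂ) (N₀ : ℝ) (h : 0 < N₀) (r : ℂ) :
    0 ≤ mixDensity S N₀ r := by
  unfold mixDensity
  positivity

lemma log_bound_aux (S : Finset ℂ) (hS : S.Nonempty) (N₀ : ℝ) (hN : 0 < N₀) (μ : ℂ) :
    ∃ K : ℝ, 0 ≤ K ∧ ∀ r, |Real.log (mixDensity S N₀ r)| ≤ K + 2 / N₀ * ‖r - μ‖ ^ 2 := by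
  obtain ⟨m, hm⟩ := hS
  have hc : (0 : ℝ) < S.card := by exact_mod_cast Finset.card_pos.mpr ⟨m, hm⟩
  have hC : 0 < (π * N₀)⁻¹ := by positivity
  set C := (π * N₀)⁻¹ with hCdef
  set c := (S.card : ℝ)⁻¹ * C with hcdef
  have hc0 : 0 < c := by positivity
  refine ⟨|Real.log c| + |Real.log C| + 2 / N₀ * ‖μ - m‖ ^ 2, by positivity, fun r => ?_⟩
  have hlow : c * Real.exp (-(‖r - m‖) ^ 2 / N₀) ≤ mixDensity S N₀ r := by
    unfold mixDensity
    rw [hcdef, mul_assoc]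
    refine mul_le_mul_of_nonneg_left ?_ (by positivity)
    exact Finset.single_le_sum (f := fun μ => C * Real.exp (-(‖r - μ‖) ^ 2 / N₀))
      (fun i _ => by positivity) hm
  have hup : mixDensity S N₀ r ≤ C := by
    unfold mixDensity
    rw [inv_mul_le_iff₀ hc, ← nsmul_eq_mul]
    refine Finset.sum_le_card_nsmul _ _ _ fun i _ => ?_
    refine mul_le_of_le_one_right hC.le (Real.exp_le_one_iff.mpr ?_)
    rw [neg_div]
    have : 0 ≤ ‖r - i‖ ^ 2 / N₀ := by positivity
    linarith
  have hpos : 0 < mixDensity S N₀ r := lt_of_lt_of_le (by positivity) hlow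
  have h1 := Real.log_le_log (by positivity) hlow
  rw [Real.log_mul hc0.ne' (Real.exp_pos _).ne', Real.log_exp] at h1
  have h2 := Real.log_le_log hpos hup
  have htri : ‖r - m‖ ≤ ‖r - μ‖ + ‖μ - m‖ := norm_sub_le_norm_sub_add_norm_sub r μ m
  have hsq : ‖r - m‖ ^ 2 ≤ 2 * ‖r - μ‖ ^ 2 + 2 * ‖μ - m‖ ^ 2 := by
    nlinarith [norm_nonneg (r - m), norm_nonneg (r - μ), norm_nonneg (μ - m),
      sq_nonneg (‖r - μ‖ - ‖μ - m‖)]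
  have hdiv : ‖r - m‖ ^ 2 / N₀ ≤ 2 / N₀ * ‖r - μ‖ ^ 2 + 2 / N₀ * ‖μ - m‖ ^ 2 := by
    calc _ ≤ (2 * ‖r - μ‖ ^ 2 + 2 * ‖μ - m‖ ^ 2) / N₀ := by gcongr
      _ = _ := by ring
  have hA : 0 ≤ 2 / N₀ * ‖r - μ‖ ^ 2 := by positivity
  have hB : 0 ≤ 2 / N₀ * ‖μ - m‖ ^ 2 := by positivity
  rw [neg_div] at h1
  rw [abs_le]
  constructor
  · linarith [neg_abs_le (Real.log c), abs_nonneg (Real.log C)]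
  · linarith [le_abs_self (Real.log C), abs_nonneg (Real.log c)]

/-- The log of one mixture density is integrable with respect to the
probability measure of another. -/
theorem integrable_log_mixDensity (S S' : Finset ℂ) (hS : S.Nonempty) (hS' : S'.Nonempty)
    (N₀ N₀' : ℝ) (hN₀ : 0 < N₀) (hN₀' : 0 < N₀') :
    Integrable (fun r => Real.log (mixDensity S' N₀' r)) (mixMeasure S N₀) := by
  have hlogm : Measurable (fun r => Real.log (mixDensity S' N₀' r)) :=
    (mixDensity_continuous_aux S' N₀').measurable.log
  unfold mixMeasure
  rw [integrable_withDensity_iff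
    (mixDensity_continuous_aux S N₀).measurable.ennreal_ofReal (by simp)]
  have key : ∀ μ ∈ S, Integrable (fun r : ℂ => (π * N₀)⁻¹ *
      (Real.log (mixDensity S' N₀' r) * Real.exp (-(‖r - μ‖) ^ 2 / N₀))) := by
    intro μ _
    refine Integrable.const_mul ?_ _
    obtain ⟨K, hK, hb⟩ := log_bound_aux S' hS' N₀' hN₀' μ
    refine ((gauss_integrable_aux (1 / (2 * N₀)) (by positivity) μ).const_mul
      (K + 2 / N₀' * (2 * N₀))).mono' ?_ (ae_of_all _ fun r => ?_)
    · exact (hlogm.mul (by fun_prop)).aestronglyMeasurable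
    · rw [norm_mul, Real.norm_eq_abs, Real.norm_eq_abs, Real.abs_exp]
      set t := ‖r - μ‖ ^ 2 with ht
      have ht0 : 0 ≤ t := by positivity
      have hL : 0 < 2 / N₀' := by positivity
      have hu : 0 ≤ t / (2 * N₀) := by positivity
      have hexp := Real.add_one_le_exp (t / (2 * N₀))
      have e1 : Real.exp (-(1 / (2 * N₀)) * t) =
          Real.exp (t / (2 * N₀)) * Real.exp (-t / N₀) := by
        rw [← Real.exp_add]
        congr 1
        field_simp
        ring
      rw [e1, ← mul_assoc]
      refine mul_le_mul_of_nonneg_right ((hb r).trans ?_) (Real.exp_pos _).le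
      have e2 : t = 2 * N₀ * (t / (2 * N₀)) := by field_simp
      have a1 : K ≤ K * Real.exp (t / (2 * N₀)) := le_mul_of_one_le_right hK (by linarith)
      have a2 : 2 / N₀' * t ≤ 2 / N₀' * (2 * N₀) * Real.exp (t / (2 * N₀)) := by
        rw [mul_assoc]
        refine mul_le_mul_of_nonneg_left ?_ hL.le
        calc t = 2 * N₀ * (t / (2 * N₀)) := e2
          _ ≤ _ := mul_le_mul_of_nonneg_left (by linarith) (by positivity)
      linarith
  refine ((integrable_finsetSum S key).const_mul (S.card : ℝ)⁻¹).congr (ae_of_all _ fun r => ?_)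
  simp only [ENNReal.toReal_ofReal (mixDensity_nonneg_aux S N₀ hN₀ r)]
  conv_rhs => rw [mixDensity.eq_def S N₀ r]
  rw [mul_left_comm, Finset.mul_sum (a := Real.log _)]
  congr 1
  exact Finset.sum_congr rfl fun i _ => by ring
end

section
/- Let S, S' ⊆ ℂ be finite nonempty sets, N₀, N₀' > 0 real numbers, and let (r_n)_{n≥1} be an i.i.d. sequence of ℂ-valued random variables with law P_{S,N₀}. Then, almost surely, −(1/N)·Σ_{n=1}^{N} log f_{S',N₀'}(r_n) converges as N → ∞ to −∫ log f_{S',N₀'} dP_{S,N₀}, and this limit equals klDiv(P_{S,N₀}, P_{S',N₀'}) + h, where h = −∫ log f_{S,N₀} dP_{S,N₀} is the differential entropy of P_{S,N₀}. -/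
open Real MeasureTheory ProbabilityTheory Filter

lemma aux_pos (S : Finset ℂ) (hS : S.Nonempty) (N : ℝ) (hN : 0 < N) (x : ℂ) :
    0 < mixDensity S N x := by
  unfold mixDensity
  have : 0 < (S.card : ℝ) := by exact_mod_cast hS.card_pos
  refine mul_pos (inv_pos.2 this) (Finset.sum_pos (fun i _ => ?_) hS)
  positivity

lemma aux_cont (S : Finset ℂ) (N : ℝ) : Continuous (mixDensity S N) := by
  unfold mixDensity
  fun_prop

lemma aux_gauss (N : ℝ) (hN : 0 < N) : Integrable (fun x : ℂ => Real.exp (-(‖x‖) ^ 2 / N)) := by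
  have h := (GaussianFourier.integrable_cexp_neg_mul_sq_norm_add (V := ℂ) (b := ((1 / N : ℝ) : ℂ))
    (by rw [Complex.ofReal_re]; positivity) 0 0).norm
  refine h.congr (ae_of_all _ fun x => ?_)
  simp only [Complex.norm_exp]
  congr 1
  have : (-(((1 / N : ℝ) : ℂ)) * (‖x‖ : ℂ) ^ 2 + 0 * ((inner ℝ (0 : ℂ) x : ℝ) : ℂ))
      = ((-(‖x‖) ^ 2 / N : ℝ) : ℂ) := by
    push_cast; ring
  rw [this, Complex.ofReal_re]

lemma aux_gauss_sq (N : ℝ) (hN : 0 < N) :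
    Integrable (fun x : ℂ => ‖x‖ ^ 2 * Real.exp (-(‖x‖) ^ 2 / N)) := by
  refine ((aux_gauss (2 * N) (by positivity)).const_mul (2 * N)).mono'
    (by fun_prop) (ae_of_all _ fun x => ?_)
  rw [Real.norm_of_nonneg (by positivity)]
  have h1 : ‖x‖ ^ 2 / (2 * N) ≤ Real.exp (‖x‖ ^ 2 / (2 * N)) := by
    linarith [Real.add_one_le_exp (‖x‖ ^ 2 / (2 * N))]
  have h2 : Real.exp (-‖x‖ ^ 2 / (2 * N))
      = Real.exp (‖x‖ ^ 2 / (2 * N)) * Real.exp (-‖x‖ ^ 2 / N) := by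
    rw [← Real.exp_add]; congr 1; field_simp; ring
  rw [h2, ← mul_assoc]
  gcongr
  rw [div_le_iff₀ (by positivity)] at h1
  linarith

lemma aux_int_quad (S : Finset ℂ) (N : ℝ) (hN : 0 < N) (A B : ℝ) (hA : 0 ≤ A) (hB : 0 ≤ B) :
    Integrable (fun x : ℂ => mixDensity S N x * (A + B * ‖x‖ ^ 2)) := by
  have key : ∀ μ : ℂ, Integrable
      (fun x : ℂ => (A + B * ‖x‖ ^ 2) * Real.exp (-(‖x - μ‖) ^ 2 / N)) := by
    intro μ
    have h := (((aux_gauss N hN).const_mul (A + 2 * B * ‖μ‖ ^ 2)).add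
      ((aux_gauss_sq N hN).const_mul (2 * B))).comp_sub_right μ
    refine h.mono' (by fun_prop) (ae_of_all _ fun x => ?_)
    rw [Real.norm_of_nonneg (by positivity)]
    simp only [Pi.add_apply]
    rw [← mul_assoc, ← add_mul]
    refine mul_le_mul_of_nonneg_right ?_ (Real.exp_pos _).le
    have h1 : ‖x‖ ≤ ‖x - μ‖ + ‖μ‖ := by simpa using norm_add_le (x - μ) μ
    have h2 : ‖x‖ ^ 2 ≤ 2 * ‖x - μ‖ ^ 2 + 2 * ‖μ‖ ^ 2 := by
      nlinarith [sq_nonneg (‖x - μ‖ - ‖μ‖), norm_nonneg x]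
    nlinarith
  have h := (integrable_finsetSum S (fun μ _ => (key μ).const_mul ((π * N)⁻¹))).const_mul
    ((S.card : ℝ)⁻¹)
  refine h.congr (ae_of_all _ fun x => ?_)
  simp only [mixDensity]
  rw [mul_assoc, Finset.sum_mul]
  congr 1
  refine Finset.sum_congr rfl fun μ _ => ?_
  ring

lemma aux_log_bound (S : Finset ℂ) (hS : S.Nonempty) (N : ℝ) (hN : 0 < N) :
    ∃ A B : ℝ, 0 ≤ A ∧ 0 ≤ B ∧ ∀ x, |Real.log (mixDensity S N x)| ≤ A + B * ‖x‖ ^ 2 := by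
  obtain ⟨μ, hμ⟩ := hS
  have hc : 0 < (S.card : ℝ) := by exact_mod_cast Finset.card_pos.2 ⟨μ, hμ⟩
  set U : ℝ := (π * N)⁻¹ with hU
  have hU0 : 0 < U := by positivity
  set c : ℝ := (S.card : ℝ)⁻¹ * U with hcc
  have hc0 : 0 < c := by positivity
  refine ⟨|Real.log U| + |Real.log c| + 2 * ‖μ‖ ^ 2 / N, 2 / N, by positivity, by positivity,
    fun x => ?_⟩
  have hup : mixDensity S N x ≤ U := by
    unfold mixDensity
    rw [inv_mul_le_iff₀ hc]
    have : ∀ i ∈ S, U * Real.exp (-(‖x - i‖) ^ 2 / N) ≤ U := fun i _ => by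
      have : Real.exp (-(‖x - i‖) ^ 2 / N) ≤ 1 := by
        rw [Real.exp_le_one_iff, neg_div]
        have : 0 ≤ ‖x - i‖ ^ 2 / N := by positivity
        linarith
      nlinarith
    refine (Finset.sum_le_sum this).trans ?_
    simp
  have hlow : c * Real.exp (-(‖x - μ‖) ^ 2 / N) ≤ mixDensity S N x := by
    unfold mixDensity
    rw [hcc, mul_assoc]
    gcongr
    exact Finset.single_le_sum (f := fun i => U * Real.exp (-(‖x - i‖) ^ 2 / N))
      (fun i _ => by positivity) hμ
  have l1 := Real.log_le_log (aux_pos S ⟨μ, hμ⟩ N hN x) hup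
  have l2 := Real.log_le_log (by positivity) hlow
  rw [Real.log_mul hc0.ne' (Real.exp_pos _).ne', Real.log_exp] at l2
  have h1 : ‖x - μ‖ ≤ ‖x‖ + ‖μ‖ := norm_sub_le _ _
  have h2 : ‖x - μ‖ ^ 2 ≤ 2 * ‖x‖ ^ 2 + 2 * ‖μ‖ ^ 2 := by
    nlinarith [sq_nonneg (‖x‖ - ‖μ‖), norm_nonneg (x - μ)]
  have h3 : ‖x - μ‖ ^ 2 / N ≤ 2 / N * ‖x‖ ^ 2 + 2 * ‖μ‖ ^ 2 / N := by
    calc _ ≤ (2 * ‖x‖ ^ 2 + 2 * ‖μ‖ ^ 2) / N := by gcongr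
      _ = _ := by ring
  rw [neg_div] at l2
  have p1 : 0 ≤ 2 / N * ‖x‖ ^ 2 := by positivity
  have p2 : 0 ≤ 2 * ‖μ‖ ^ 2 / N := by positivity
  rw [abs_le]
  constructor
  · linarith [neg_abs_le (Real.log c), abs_nonneg (Real.log U)]
  · linarith [le_abs_self (Real.log U), abs_nonneg (Real.log c)]

lemma aux_int_log (S S' : Finset ℂ) (hS : S.Nonempty) (hS' : S'.Nonempty)
    (N N' : ℝ) (hN : 0 < N) (hN' : 0 < N') :
    Integrable (fun x => Real.log (mixDensity S' N' x)) (mixMeasure S N) := by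
  obtain ⟨A, B, hA, hB, h⟩ := aux_log_bound S' hS' N' hN'
  have hm : Measurable fun x => Real.log (mixDensity S' N' x) :=
    (aux_cont S' N').measurable.log
  unfold mixMeasure
  rw [integrable_withDensity_iff (aux_cont S N).measurable.ennreal_ofReal
    (ae_of_all _ fun x => ENNReal.ofReal_lt_top)]
  refine (aux_int_quad S N hN A B hA hB).mono'
    (hm.mul (aux_cont S N).measurable.ennreal_ofReal.ennreal_toReal).aestronglyMeasurable
    (ae_of_all _ fun x => ?_)
  have := (aux_pos S hS N hN x).le
  rw [ENNReal.toReal_ofReal this, norm_mul, Real.norm_of_nonneg this, mul_comm, Real.norm_eq_abs]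
  gcongr
  exact h x

lemma aux_llr (S S' : Finset ℂ) (hS : S.Nonempty) (hS' : S'.Nonempty)
    (N N' : ℝ) (hN : 0 < N) (hN' : 0 < N') [IsFiniteMeasure (mixMeasure S N)] :
    llr (mixMeasure S N) (mixMeasure S' N') =ᵐ[mixMeasure S N]
      fun x => Real.log (mixDensity S N x) - Real.log (mixDensity S' N' x) := by
  have m' := (aux_cont S' N').measurable.ennreal_ofReal
  have m := (aux_cont S N).measurable.ennreal_ofReal
  have e1 := Measure.rnDeriv_withDensity_right (mixMeasure S N) (volume : Measure ℂ)
    m'.aemeasurable (ae_of_all _ fun x => by simp [aux_pos S' hS' N' hN' x])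
    (ae_of_all _ fun x => ENNReal.ofReal_ne_top)
  have e2 := Measure.rnDeriv_withDensity (volume : Measure ℂ) m
  refine (withDensity_absolutelyContinuous _ _ : mixMeasure S N ≪ volume).ae_le ?_
  filter_upwards [e1, e2] with x h1 h2
  change Measure.rnDeriv (mixMeasure S N) (mixMeasure S' N') x = _ at h1
  change Measure.rnDeriv (mixMeasure S N) volume x = _ at h2
  have p := aux_pos S hS N hN x
  have p' := aux_pos S' hS' N' hN' x
  rw [llr, h1, h2, ENNReal.toReal_mul, ENNReal.toReal_inv, ENNReal.toReal_ofReal p.le,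
    ENNReal.toReal_ofReal p'.le, Real.log_mul (inv_pos.2 p').ne' p.ne', Real.log_inv]
  ring

lemma aux_ac (S S' : Finset ℂ) (hS' : S'.Nonempty)
    (N N' : ℝ) (hN' : 0 < N') : mixMeasure S N ≪ mixMeasure S' N' := by
  refine (withDensity_absolutelyContinuous _ _ : mixMeasure S N ≪ volume).trans ?_
  refine withDensity_absolutelyContinuous' (aux_cont S' N').measurable.ennreal_ofReal.aemeasurable
    (ae_of_all _ fun x => by simp [aux_pos S' hS' N' hN' x])

/-- Almost-sure convergence of the normalized negative log-likelihood to
`klDiv + h`, where `h` is the differential entropy of the true distribution. -/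
theorem negLogLik_tendsto_klDiv_add_entropy {Ω : Type*} [MeasureSpace Ω]
    [IsProbabilityMeasure (ℙ : Measure Ω)]
    (S S' : Finset ℂ) (hS : S.Nonempty) (hS' : S'.Nonempty)
    (N₀ N₀' : ℝ) (hN₀ : 0 < N₀) (hN₀' : 0 < N₀')
    (r : ℕ → Ω → ℂ) (hmeas : ∀ n, Measurable (r n))
    (hindep : iIndepFun r ℙ)
    (hlaw : ∀ n, Measure.map (r n) ℙ = mixMeasure S N₀) :
    (∀ᵐ ω ∂(ℙ : Measure Ω),
      Tendsto
        (fun N : ℕ =>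
          -(1 / (N : ℝ)) * ∑ n ∈ Finset.range N, Real.log (mixDensity S' N₀' (r n ω)))
        atTop
        (nhds (-∫ x, Real.log (mixDensity S' N₀' x) ∂(mixMeasure S N₀)))) ∧
    ((-∫ x, Real.log (mixDensity S' N₀' x) ∂(mixMeasure S N₀) : ℝ) : EReal) =
      klDiv (mixMeasure S N₀) (mixMeasure S' N₀')
        + ((-∫ x, Real.log (mixDensity S N₀ x) ∂(mixMeasure S N₀) : ℝ) : EReal) := by
  have hfin : IsFiniteMeasure (mixMeasure S N₀) := by
    rw [← hlaw 0]; infer_instance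
  have hi := aux_int_log S S' hS hS' N₀ N₀' hN₀ hN₀'
  have hi0 := aux_int_log S S hS hS N₀ N₀ hN₀ hN₀
  have hm : Measurable fun x => Real.log (mixDensity S' N₀' x) :=
    (aux_cont S' N₀').measurable.log
  constructor
  · have hint : Integrable (fun ω => Real.log (mixDensity S' N₀' (r 0 ω))) ℙ := by
      rw [← hlaw 0] at hi
      exact hi.comp_measurable (hmeas 0)
    have hl := strong_law_ae_real (μ := (ℙ : Measure Ω))
      (fun n ω => Real.log (mixDensity S' N₀' (r n ω))) hint
      (fun i j hij => (hindep.indepFun hij).comp hm hm)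
      (fun i => (IdentDistrib.mk (hmeas i).aemeasurable (hmeas 0).aemeasurable
        (by rw [hlaw i, hlaw 0])).comp hm)
    have he : ∫ x, Real.log (mixDensity S' N₀' x) ∂(mixMeasure S N₀)
        = ∫ ω, Real.log (mixDensity S' N₀' (r 0 ω)) ∂ℙ := by
      rw [← hlaw 0, integral_map (hmeas 0).aemeasurable hm.aestronglyMeasurable]
    rw [he]
    filter_upwards [hl] with ω hω
    refine hω.neg.congr fun n => ?_
    ring
  · have hllr := aux_llr S S' hS hS' N₀ N₀' hN₀ hN₀'
    have hli : Integrable (llr (mixMeasure S N₀) (mixMeasure S' N₀')) (mixMeasure S N₀) :=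
      (hi0.sub hi).congr hllr.symm
    unfold klDiv
    rw [if_pos ⟨aux_ac S S' hS' N₀ N₀' hN₀', hli⟩, integral_congr_ae hllr, integral_sub hi0 hi,
      ← EReal.coe_add]
    congr 1
    ring
end

section
/- Let N ≥ 1 be an integer, Γ, N₀ > 0 real numbers, and I ∈ ℂ^N a fixed vector. Then for every r ∈ ℂ^N, ∫_0^∞ ∫_0^{2π} (2a/Γ)·exp(−a²/Γ) · (1/(2π)) · (πN₀)^{−N} · exp( −Σ_{k=1}^N |r_k − a·e^{iθ}·I_k|²/N₀ ) dθ da = (πN₀)^{−N} · (1/(1 + (Γ/N₀)·‖I‖²)) · exp( (Γ/N₀²)·|Σ_{k=1}^N conj(I_k)·r_k|² / (1 + (Γ/N₀)·‖I‖²) − ‖r‖²/N₀ ), where ‖I‖² = Σ_k |I_k|², ‖r‖² = Σ_k |r_k|², and conj denotes complex conjugation. -/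
open Real MeasureTheory

lemma polar_gauss (B : ℝ) (hB : 0 < B) (c : ℂ) :
    ∫ a in Set.Ioi (0 : ℝ), ∫ θ in (0 : ℝ)..(2 * π),
      a * Real.exp (-B * ‖(a : ℂ) * Complex.exp (Complex.I * (θ : ℂ)) - c‖ ^ 2) = π / B := by
  have h1 : ∫ z : ℂ, Real.exp (-B * ‖z - c‖ ^ 2) = π / B := by
    rw [integral_sub_right_eq_self (fun z : ℂ => Real.exp (-B * ‖z‖ ^ 2)) c]
    rw [GaussianFourier.integral_rexp_neg_mul_sq_norm hB]
    simp
  have h2 := Complex.integral_comp_polarCoord_symm (fun z : ℂ => Real.exp (-B * ‖z - c‖ ^ 2))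
  rw [h1] at h2
  have hne : π / B ≠ 0 := by positivity
  rw [polarCoord_target, Measure.volume_eq_prod, setIntegral_prod] at h2
  · rw [← h2]
    refine setIntegral_congr_fun measurableSet_Ioi fun a _ => ?_
    have hp : Function.Periodic (fun θ : ℝ =>
        a * Real.exp (-B * ‖(a : ℂ) * Complex.exp (Complex.I * (θ : ℂ)) - c‖ ^ 2)) (2 * π) := by
      intro θ
      have : Complex.exp (Complex.I * ((θ + 2 * π : ℝ) : ℂ)) = Complex.exp (Complex.I * θ) := by
        rw [← Complex.exp_periodic (Complex.I * θ)]
        congr 1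
        push_cast
        ring
      simp only [this]
    have h3 := hp.intervalIntegral_add_eq 0 (-π)
    rw [zero_add, show -π + 2 * π = π by ring] at h3
    simp only []
    rw [h3, intervalIntegral.integral_of_le (by linarith [pi_pos]), integral_Ioc_eq_integral_Ioo]
    refine setIntegral_congr_fun measurableSet_Ioo fun θ _ => ?_
    simp only [Complex.polarCoord_symm_apply, smul_eq_mul]
    rw [mul_comm Complex.I, Complex.exp_mul_I, Complex.ofReal_cos, Complex.ofReal_sin]
  · by_contra hcon
    rw [integral_undef hcon] at h2
    exact hne h2.symm

lemma sq_expand (w r I : ℂ) : ‖r - w * I‖ ^ 2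
    = ‖r‖ ^ 2 - 2 * (w * (starRingEnd ℂ) ((starRingEnd ℂ) I * r)).re + ‖w‖ ^ 2 * ‖I‖ ^ 2 := by
  simp only [← Complex.normSq_eq_norm_sq, Complex.normSq_apply]
  simp
  ring

lemma sum_expand {N : ℕ} (w : ℂ) (r I : Fin N → ℂ) : ∑ k, ‖r k - w * I k‖ ^ 2
    = (∑ k, ‖r k‖ ^ 2) - 2 * (w * (starRingEnd ℂ) (∑ k, (starRingEnd ℂ) (I k) * r k)).re
      + ‖w‖ ^ 2 * ∑ k, ‖I k‖ ^ 2 := by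
  simp only [sq_expand, Finset.sum_add_distrib, Finset.sum_sub_distrib, map_sum, Finset.mul_sum,
    Complex.re_sum]

lemma sq_complete (B t : ℝ) (w W : ℂ) : ‖w - (t : ℂ) * W‖ ^ 2
    = ‖w‖ ^ 2 - 2 * t * (w * (starRingEnd ℂ) W).re + t ^ 2 * ‖W‖ ^ 2 := by
  simp only [← Complex.normSq_eq_norm_sq, Complex.normSq_apply]
  simp
  ring

/-- **eq. (avlf1), conditional on one symbol sequence.** Closed form of the ALRT
likelihood after marginalizing the Rayleigh fading amplitude and the uniform channel phase. -/
theorem alrt_marginalization_closed_form (N : ℕ) (hN : 1 ≤ N)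
    (Γ N₀ : ℝ) (hΓ : 0 < Γ) (hN₀ : 0 < N₀) (I r : Fin N → ℂ) :
    (∫ a in Set.Ioi (0 : ℝ), ∫ θ in (0 : ℝ)..(2 * π),
        (2 * a / Γ) * Real.exp (-a ^ 2 / Γ) * (2 * π)⁻¹ * ((π * N₀) ^ N)⁻¹ *
          Real.exp (-(∑ k, (
            ‖r k - (a : ℂ) * Complex.exp (Complex.I * (θ : ℂ)) * I k‖) ^ 2) / N₀))
      = ((π * N₀) ^ N)⁻¹ * (1 + (Γ / N₀) * ∑ k, (‖I k‖) ^ 2)⁻¹ *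
          Real.exp ((Γ / N₀ ^ 2) *
              (‖∑ k, (starRingEnd ℂ) (I k) * r k‖) ^ 2
                / (1 + (Γ / N₀) * ∑ k, (‖I k‖) ^ 2)
            - (∑ k, (‖r k‖) ^ 2) / N₀) := by
  set S := ∑ k, ‖I k‖ ^ 2 with hS
  set R := ∑ k, ‖r k‖ ^ 2 with hR
  set W := ∑ k, (starRingEnd ℂ) (I k) * r k with hW
  have hS0 : 0 ≤ S := Finset.sum_nonneg fun _ _ => by positivity
  have hD : 0 < 1 + Γ / N₀ * S := by positivity
  obtain ⟨D, hDd⟩ : ∃ D, D = 1 + Γ / N₀ * S := ⟨_, rfl⟩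
  rw [← hDd] at hD ⊢
  have hSD : S = (D - 1) * N₀ / Γ := by rw [hDd]; field_simp; ring
  have hB : 0 < D / Γ := by positivity
  have key := polar_gauss (D / Γ) hB (((Γ / (N₀ * D) : ℝ) : ℂ) * W)
  set E := Real.exp (Γ / N₀ ^ 2 * ‖W‖ ^ 2 / D - R / N₀) with hE
  set P := ((π * N₀) ^ N)⁻¹ with hP
  have hint : ∀ a θ : ℝ, (2 * a / Γ) * Real.exp (-a ^ 2 / Γ) * (2 * π)⁻¹ * P *
          Real.exp (-(∑ k, (
            ‖r k - (a : ℂ) * Complex.exp (Complex.I * (θ : ℂ)) * I k‖) ^ 2) / N₀)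
      = (P * E / (π * Γ)) * (a * Real.exp (-(D / Γ) * ‖(a : ℂ) * Complex.exp (Complex.I * (θ : ℂ))
          - ((Γ / (N₀ * D) : ℝ) : ℂ) * W‖ ^ 2)) := by
    intro a θ
    have hn : ‖(a : ℂ) * Complex.exp (Complex.I * (θ : ℂ))‖ ^ 2 = a ^ 2 := by
      rw [norm_mul, mul_comm Complex.I, Complex.norm_exp_ofReal_mul_I, mul_one,
        Complex.norm_real, Real.norm_eq_abs, sq_abs]
    rw [sum_expand, sq_complete 0, hn, ← hW, ← hR, ← hS, hSD]
    generalize ((a : ℂ) * Complex.exp (Complex.I * (θ : ℂ)) * (starRingEnd ℂ) W).re = x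
    have he : Real.exp (-a ^ 2 / Γ) *
        Real.exp (-(R - 2 * x + a ^ 2 * ((D - 1) * N₀ / Γ)) / N₀) =
        E * Real.exp (-(D / Γ) * (a ^ 2 - 2 * (Γ / (N₀ * D)) * x
          + (Γ / (N₀ * D)) ^ 2 * ‖W‖ ^ 2)) := by
      rw [hE, ← Real.exp_add, ← Real.exp_add]
      congr 1
      field_simp
      ring
    calc _ = (2 * a / Γ) * (2 * π)⁻¹ * P * (Real.exp (-a ^ 2 / Γ) *
        Real.exp (-(R - 2 * x + a ^ 2 * ((D - 1) * N₀ / Γ)) / N₀)) := by ring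
      _ = _ := by
        rw [he]
        field_simp
  simp only [hint, intervalIntegral.integral_const_mul, integral_const_mul] 
  simp only [intervalIntegral.integral_const_mul] at key
  rw [key]
  field_simp
end
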